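/- (Davenport's Shrinking Lemma) Let $L$ be a symmetric real $n \times n$ matrix with rows $L_1, \dots, L_n$ (viewed as linear forms $L_i(\mathbf{x})$), let $P \ge 1$ and $0 < Z < 1$ be real numbers. Then $\#\{\mathbf{x} \in \mathbb{Z}^n : |\mathbf{x}| \le P,\ \|L_i(\mathbf{x})\| < \tfrac{1}{2nP}\ \forall i\} \le (4/Z)^n \cdot \#\{\mathbf{x} \in \mathbb{Z}^n : |\mathbf{x}| \le ZP,\ \|L_i(\mathbf{x})\| < \tfrac{Z}{2nP}\ \forall i\}$. -/

import Mathlib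

/-- Distance from a real number to a nearest integer. -/
noncomputable def distNearestInt (z : ℝ) : ℝ := |z - round z|

open MeasureTheory Metric Module in
/-- Volume packing bound for separated families in the unit ball. -/
lemma shrink_card_sep {E ι : Type*} [NormedAddCommGroup E] [NormedSpace ℝ E]
    [FiniteDimensional ℝ E] (T : Finset ι) (g : ι → E) (Z : ℝ) (hZ0 : 0 < Z) (hZ1 : Z < 1)
    (hg : ∀ i ∈ T, ‖g i‖ ≤ 1) (h : ∀ i ∈ T, ∀ j ∈ T, i ≠ j → Z ≤ ‖g i - g j‖) :
    (T.card : ℝ) ≤ (4 / Z) ^ finrank ℝ E := by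
  borelize E
  let μ : Measure E := Measure.addHaar
  have δpos : 0 < Z / 2 := by positivity
  have ρpos : 0 < 1 + Z / 2 := by positivity
  have D : Set.Pairwise (T : Set ι) (Function.onFun Disjoint fun c => ball (g c) (Z / 2)) := by
    rintro c hc d hd hcd
    apply ball_disjoint_ball
    rw [dist_eq_norm]
    have := h c hc d hd hcd
    linarith
  have A_subset : (⋃ c ∈ T, ball (g c) (Z / 2)) ⊆ ball (0 : E) (1 + Z / 2) := by
    refine Set.iUnion₂_subset fun x hx => ?_
    apply ball_subset_ball'
    rw [dist_zero_right]
    linarith [hg x hx]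
  have I : (T.card : ENNReal) * ENNReal.ofReal ((Z / 2) ^ finrank ℝ E) * μ (ball 0 1) ≤
      ENNReal.ofReal ((1 + Z / 2) ^ finrank ℝ E) * μ (ball 0 1) :=
    calc
      _ = μ (⋃ c ∈ T, ball (g c) (Z / 2)) := by
        rw [measure_biUnion_finset D fun c _ => measurableSet_ball]
        simp only [μ.addHaar_ball_of_pos _ δpos]
        simp only [Finset.sum_const, nsmul_eq_mul, mul_assoc]
      _ ≤ μ (ball (0 : E) (1 + Z / 2)) := measure_mono A_subset
      _ = _ := by simp only [μ.addHaar_ball_of_pos _ ρpos]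
  have J : (T.card : ENNReal) * ENNReal.ofReal ((Z / 2) ^ finrank ℝ E) ≤
      ENNReal.ofReal ((1 + Z / 2) ^ finrank ℝ E) :=
    (ENNReal.mul_le_mul_iff_left (measure_ball_pos _ _ zero_lt_one).ne' measure_ball_lt_top.ne).1 I
  have K := ENNReal.toReal_le_of_le_ofReal (pow_nonneg ρpos.le _) J
  rw [ENNReal.toReal_mul, ENNReal.toReal_ofReal (by positivity), ENNReal.toReal_natCast] at K
  have h1 : (1 + Z / 2) ^ finrank ℝ E ≤ (4 / Z) ^ finrank ℝ E * (Z / 2) ^ finrank ℝ E := by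
    rw [← mul_pow]
    apply pow_le_pow_left₀ ρpos.le
    have : 4 / Z * (Z / 2) = 2 := by field_simp; norm_num
    linarith
  exact le_of_mul_le_mul_right (K.trans h1) (by positivity)

/-- A maximal separated subset. -/
lemma shrink_exists_maximal {α : Type*} [Finite α] (R : α → α → Prop)
    (hr : ∀ a, R a a) (hs : ∀ a b, R a b → R b a) :
    ∃ T : Finset α, (∀ a ∈ T, ∀ b ∈ T, a ≠ b → ¬ R a b) ∧ ∀ a, ∃ b ∈ T, R a b := by
  classical
  have := Fintype.ofFinite α
  obtain ⟨T, hT⟩ := (Set.toFinite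
    {T : Finset α | ∀ a ∈ T, ∀ b ∈ T, a ≠ b → ¬ R a b}).exists_maximal ⟨∅, by simp⟩
  refine ⟨T, hT.1, fun a => ?_⟩
  by_contra! hc
  have haT : a ∉ T := fun h => hc a h (hr a)
  have h1 : insert a T ∈ {T : Finset α | ∀ a ∈ T, ∀ b ∈ T, a ≠ b → ¬ R a b} := by
    intro x hx y hy hxy
    rw [Finset.mem_insert] at hx hy
    rcases hx with rfl | hx <;> rcases hy with rfl | hy
    · exact absurd rfl hxy
    · exact hc y hy
    · exact fun h => hc x hx (hs _ _ h)
    · exact hT.1 x hx y hy hxy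
  exact haT (hT.2 h1 (Finset.subset_insert a T) (Finset.mem_insert_self a T))

/-- The standard symplectic form. -/
noncomputable def shrinkForm {n : ℕ} (v w : (Fin n → ℝ) × (Fin n → ℝ)) : ℝ :=
  ∑ i, (v.1 i * w.2 i - w.1 i * v.2 i)

open Module in
/-- Isotropic subspaces have dimension at most `n`. -/
lemma shrink_finrank {n : ℕ} (V : Submodule ℝ ((Fin n → ℝ) × (Fin n → ℝ)))
    (hV : ∀ v ∈ V, ∀ w ∈ V, shrinkForm v w = 0) : finrank ℝ V ≤ n := by
  let J : ((Fin n → ℝ) × (Fin n → ℝ)) →ₗ[ℝ] ((Fin n → ℝ) × (Fin n → ℝ)) :=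
    LinearMap.prod (-LinearMap.snd ℝ _ _) (LinearMap.fst ℝ _ _)
  have hJ : Function.Injective J := by
    rintro ⟨a, b⟩ ⟨c, d⟩ h
    have h1 : -b = -d := congrArg Prod.fst h
    have h2 : a = c := congrArg Prod.snd h
    rw [neg_inj.1 h1, h2]
  have hd : Disjoint V (V.map J) := by
    rw [Submodule.disjoint_def]
    rintro _ hx ⟨⟨a, b⟩, hy, rfl⟩
    have h0 : ∑ i, (a i * a i - (-b i) * b i) = 0 := hV _ hy _ hx
    rw [Finset.sum_eq_zero_iff_of_nonneg (fun i _ => by nlinarith [sq_nonneg (a i), sq_nonneg (b i)])] at h0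
    have ha : a = 0 := by
      funext i
      have := h0 i (Finset.mem_univ i)
      simp only [Pi.zero_apply]
      nlinarith [sq_nonneg (a i), sq_nonneg (b i)]
    have hb : b = 0 := by
      funext i
      have := h0 i (Finset.mem_univ i)
      simp only [Pi.zero_apply]
      nlinarith [sq_nonneg (a i), sq_nonneg (b i)]
    subst ha hb
    exact map_zero J
  have h1 := Submodule.finrank_add_finrank_le_of_disjoint hd
  rw [← (Submodule.equivMapOfInjective J hJ V).finrank_eq] at h1
  simp only [finrank_prod, finrank_fintype_fun_eq_card, Fintype.card_fin] at h1
  omega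

/-- The span of an isotropic family is isotropic. -/
lemma shrink_span {n : ℕ} (s : Set ((Fin n → ℝ) × (Fin n → ℝ)))
    (hs : ∀ v ∈ s, ∀ w ∈ s, shrinkForm v w = 0) :
    ∀ v ∈ Submodule.span ℝ s, ∀ w ∈ Submodule.span ℝ s, shrinkForm v w = 0 := by
  intro v hv w hw
  induction hv, hw using Submodule.span_induction₂ with
  | mem_mem x y hx hy => exact hs x hx y hy
  | zero_left y hy => simp [shrinkForm]
  | zero_right y hy => simp [shrinkForm]
  | add_left x y z _ _ _ h1 h2 =>
    rw [← add_zero (0 : ℝ)]; nth_rw 1 [← h1]; rw [← h2]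
    simp only [shrinkForm, ← Finset.sum_add_distrib]
    refine Finset.sum_congr rfl fun i _ => ?_
    simp; ring
  | add_right x y z _ _ _ h1 h2 =>
    rw [← add_zero (0 : ℝ)]; nth_rw 1 [← h1]; rw [← h2]
    simp only [shrinkForm, ← Finset.sum_add_distrib]
    refine Finset.sum_congr rfl fun i _ => ?_
    simp; ring
  | smul_left r x y _ _ h =>
    rw [← mul_zero r, ← h]
    simp only [shrinkForm, Finset.mul_sum]
    refine Finset.sum_congr rfl fun i _ => ?_
    simp; ring
  | smul_right r x y _ _ h =>
    rw [← mul_zero r, ← h]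
    simp only [shrinkForm, Finset.mul_sum]
    refine Finset.sum_congr rfl fun i _ => ?_
    simp; ring

/-- Boxes contain finitely many integer points. -/
lemma shrink_finite (n : ℕ) (Q : ℝ) (p : (Fin n → ℤ) → Prop) :
    Finite {x : Fin n → ℤ // (∀ i, |(x i : ℝ)| ≤ Q) ∧ p x} := by
  apply Set.Finite.subset (Set.finite_Icc (fun _ : Fin n => -⌊Q⌋) (fun _ => ⌊Q⌋))
  rintro x ⟨hx, -⟩
  have h : ∀ i, -⌊Q⌋ ≤ x i ∧ x i ≤ ⌊Q⌋ := by
    intro i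
    rw [← abs_le]
    apply Int.le_floor.2
    push_cast
    exact hx i
  exact ⟨fun i => (h i).1, fun i => (h i).2⟩

theorem davenport_shrinking_lemma (n : ℕ) (L : Matrix (Fin n) (Fin n) ℝ) (hL : L.IsSymm)
    (P Z : ℝ) (hP : 1 ≤ P) (hZ0 : 0 < Z) (hZ1 : Z < 1) :
    (Nat.card {x : Fin n → ℤ // (∀ i, |(x i : ℝ)| ≤ P) ∧
        ∀ i, distNearestInt (∑ j, L i j * (x j : ℝ)) < 1 / (2 * n * P)} : ℝ)
      ≤ (4 / Z) ^ n *
        Nat.card {x : Fin n → ℤ // (∀ i, |(x i : ℝ)| ≤ Z * P) ∧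
          ∀ i, distNearestInt (∑ j, L i j * (x j : ℝ)) < Z / (2 * n * P)} := by
  rcases Nat.eq_zero_or_pos n with rfl | hn
  · simp
  have hP0 : 0 < P := by linarith
  have hnR : (0 : ℝ) < n := by exact_mod_cast hn
  set S := {x : Fin n → ℤ // (∀ i, |(x i : ℝ)| ≤ P) ∧
        ∀ i, distNearestInt (∑ j, L i j * (x j : ℝ)) < 1 / (2 * n * P)} with hS
  set S2 := {x : Fin n → ℤ // (∀ i, |(x i : ℝ)| ≤ Z * P) ∧
          ∀ i, distNearestInt (∑ j, L i j * (x j : ℝ)) < Z / (2 * n * P)} with hS2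
  have : Finite S := shrink_finite n P _
  have : Finite S2 := shrink_finite n (Z * P) _
  let y : S → Fin n → ℤ := fun s i => round (∑ j, L i j * (s.1 j : ℝ))
  let w : S → Fin n → ℝ := fun s i => ∑ j, L i j * (s.1 j : ℝ) - y s i
  let f : S → (Fin n → ℝ) × (Fin n → ℝ) :=
    fun s => (fun i => (s.1 i : ℝ) / P, fun i => 2 * n * P * w s i)
  have hf1 : ∀ s i, |(f s).1 i| ≤ 1 := by
    intro s i
    simp only [f, abs_div, abs_of_pos hP0]
    rw [div_le_one hP0]
    exact s.2.1 i
  have hf2 : ∀ s i, |(f s).2 i| < 1 := by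
    intro s i
    have h := s.2.2 i
    simp only [f, abs_mul]
    rw [lt_div_iff₀ (by positivity)] at h
    rw [← abs_mul, ← abs_mul, abs_of_pos (by positivity : 0 < 2 * (n : ℝ) * P), mul_comm]
    exact h
  have hiso : ∀ s t, shrinkForm (f s) (f t) = 0 := by
    intro s t
    have hint : shrinkForm (f s) (f t) =
        2 * n * ((∑ i, (t.1 i * y s i - s.1 i * y t i) : ℤ) : ℝ) := by
      have hsym : ∑ i, (s.1 i : ℝ) * ∑ j, L i j * (t.1 j : ℝ) =
          ∑ i, (t.1 i : ℝ) * ∑ j, L i j * (s.1 j : ℝ) := by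
        simp only [Finset.mul_sum]
        rw [Finset.sum_comm]
        refine Finset.sum_congr rfl fun i _ => Finset.sum_congr rfl fun j _ => ?_
        rw [hL.apply i j]; ring
      have : shrinkForm (f s) (f t) = 2 * n * (∑ i, (s.1 i : ℝ) * ∑ j, L i j * (t.1 j : ℝ)
          - ∑ i, (t.1 i : ℝ) * ∑ j, L i j * (s.1 j : ℝ)
          + ∑ i, ((t.1 i : ℝ) * y s i - s.1 i * y t i)) := by
        rw [← Finset.sum_sub_distrib, ← Finset.sum_add_distrib, Finset.mul_sum]
        refine Finset.sum_congr rfl fun i _ => ?_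
        simp only [f, w]
        field_simp
        ring
      rw [this, hsym]
      push_cast
      ring
    have hlt : |shrinkForm (f s) (f t)| < 2 * n := by
      calc |shrinkForm (f s) (f t)| ≤ ∑ i, |(f s).1 i * (f t).2 i - (f t).1 i * (f s).2 i| :=
            Finset.abs_sum_le_sum_abs _ _
        _ < ∑ i : Fin n, (2 : ℝ) := by
            apply Finset.sum_lt_sum_of_nonempty ⟨⟨0, hn⟩, Finset.mem_univ _⟩
            intro i _
            have key : ∀ s t, |(f s).1 i * (f t).2 i| < 1 := fun s t => by
              rw [abs_mul]
              calc _ ≤ 1 * |(f t).2 i| := mul_le_mul_of_nonneg_right (hf1 s i) (abs_nonneg _)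
                _ < 1 := by rw [one_mul]; exact hf2 t i
            have := abs_sub ((f s).1 i * (f t).2 i) ((f t).1 i * (f s).2 i)
            linarith [key s t, key t s]
        _ = 2 * n := by simp; ring
    rw [hint] at hlt ⊢
    generalize (∑ i, (t.1 i * y s i - s.1 i * y t i) : ℤ) = k at hlt ⊢
    rw [abs_mul, abs_of_pos (by positivity : 0 < 2 * (n : ℝ))] at hlt
    have hk : |(k : ℝ)| < 1 := by
      by_contra! hc
      nlinarith
    have hk0 : k = 0 := by
      rw [← Int.abs_lt_one_iff]; exact_mod_cast hk
    simp [hk0]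
  let V := Submodule.span ℝ (Set.range f)
  have hV : Module.finrank ℝ V ≤ n := by
    apply shrink_finrank
    apply shrink_span
    rintro _ ⟨s, rfl⟩ _ ⟨t, rfl⟩
    exact hiso s t
  let g : S → V := fun s => ⟨f s, Submodule.subset_span ⟨s, rfl⟩⟩
  let R : S → S → Prop := fun s t => (∀ i, |(s.1 i : ℝ) - t.1 i| ≤ Z * P) ∧
    ∀ i, |w s i - w t i| < Z / (2 * n * P)
  obtain ⟨T, hT1, hT2⟩ := shrink_exists_maximal R
    (fun a => ⟨fun i => by simp; positivity, fun i => by simp; positivity⟩)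
    (fun a b h => ⟨fun i => by rw [abs_sub_comm]; exact h.1 i,
      fun i => by rw [abs_sub_comm]; exact h.2 i⟩)
  have hTcard : (T.card : ℝ) ≤ (4 / Z) ^ n := by
    have h1 := shrink_card_sep T g Z hZ0 hZ1 (fun s _ => by
      change ‖f s‖ ≤ 1
      rw [norm_prod_le_iff]
      exact ⟨(pi_norm_le_iff_of_nonneg zero_le_one).2 fun i => hf1 s i,
        (pi_norm_le_iff_of_nonneg zero_le_one).2 fun i => (hf2 s i).le⟩) (fun s hs t ht hst => by
      by_contra! hc
      change ‖f s - f t‖ < Z at hc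
      apply hT1 s hs t ht hst
      have hc1 := (norm_fst_le (f s - f t)).trans_lt hc
      have hc2 := (norm_snd_le (f s - f t)).trans_lt hc
      rw [pi_norm_lt_iff hZ0] at hc1 hc2
      refine ⟨fun i => ?_, fun i => ?_⟩
      · have h := hc1 i
        simp only [f, Prod.fst_sub, Pi.sub_apply, Real.norm_eq_abs] at h
        rw [← sub_div, abs_div, abs_of_pos hP0, div_lt_iff₀ hP0] at h
        exact h.le
      · have h := hc2 i
        simp only [f, Prod.snd_sub, Pi.sub_apply, Real.norm_eq_abs] at h
        rw [← mul_sub, abs_mul, abs_of_pos (by positivity : 0 < 2 * (n : ℝ) * P)] at h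
        rw [lt_div_iff₀ (by positivity), mul_comm]
        exact h)
    refine h1.trans (pow_le_pow_right₀ ?_ hV)
    rw [le_div_iff₀ hZ0]; linarith
  choose τ hτ1 hτ2 using hT2
  let F : S → T × S2 := fun s => (⟨τ s, hτ1 s⟩, ⟨s.1 - (τ s).1, fun i => by
      have := (hτ2 s).1 i
      simpa using this, fun i => by
      refine lt_of_le_of_lt (round_le _ (y s i - y (τ s) i)) ?_
      refine lt_of_eq_of_lt ?_ ((hτ2 s).2 i)
      congr 1
      simp only [w, Pi.sub_apply, Int.cast_sub, mul_sub, Finset.sum_sub_distrib]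
      ring⟩)
  have hF : Function.Injective F := by
    intro s t h
    simp only [F, Prod.mk.injEq, Subtype.mk.injEq] at h
    obtain ⟨h1, h2⟩ := h
    have h3 : s.1 - (τ s).1 = t.1 - (τ t).1 := congrArg Subtype.val h2
    rw [h1] at h3
    exact Subtype.ext (sub_left_injective h3)
  have hcard := Nat.card_le_card_of_injective F hF
  rw [Nat.card_prod, Nat.card_eq_fintype_card (α := T), Fintype.card_coe] at hcard
  calc (Nat.card S : ℝ) ≤ (T.card : ℝ) * Nat.card S2 := by exact_mod_cast hcard
    _ ≤ _ := by gcongr
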